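/- (Ebeling's theorem, Cramer/matrix form.) Let G be a finite subgroup of SU(2). Let P ∈ ℂ⟦t⟧ be the Poincaré series of the algebra of G-invariants of ℂ[x,y], i.e. the n-th coefficient of P is the dimension of the subspace of homogeneous polynomials of degree n in MvPolynomial (Fin 2) ℂ fixed by σ(u) for all u ∈ G. Let (ρ_i)_{i∈ι} be a finite family of pairwise non-isomorphic irreducible finite-dimensional complex representations of G, containing a representative of every isomorphism class, with characters χ_i, and let i₀ ∈ ι be an index with ρ_{i₀} the trivial one-dimensional representation. Let χ_emb(g) = trace of the underlying matrix of g, define the McKay matrix B : Matrix ι ι ℂ by B i j = ⟨χ_emb · χ_j, χ_i⟩, and let B° be the submatrix of B indexed by {i : ι // i ≠ i₀}. Then in ℂ⟦t⟧: P · det((1 + t²) • 1 − t • B) = det((1 + t²) • 1 − t • B°), the determinants being taken in Matrix rings over ℂ[t] and regarded as power series. -/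

import Mathlib

open MvPolynomial CategoryTheory

/-- The algebra endomorphism of `ℂ[x₁,x₂]` induced by a `2 × 2` matrix `u`,
sending the variable `X i` to `∑ j, u j i • X j`. -/
noncomputable def matrixSubst (u : Matrix (Fin 2) (Fin 2) ℂ) :
    MvPolynomial (Fin 2) ℂ →ₐ[ℂ] MvPolynomial (Fin 2) ℂ :=
  aeval fun i => ∑ j, u j i • X j

/-- The degree-`n` homogeneous component of the algebra of invariants of `G`:
homogeneous polynomials of degree `n` fixed by `σ(u)` for all `u ∈ G`. -/
noncomputable def invariantsComponent (G : Subgroup (Matrix.SpecialLinearGroup (Fin 2) ℂ))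
    (n : ℕ) : Submodule ℂ (MvPolynomial (Fin 2) ℂ) :=
  homogeneousSubmodule (Fin 2) ℂ n ⊓
    ⨅ u : G, LinearMap.eqLocus
      (matrixSubst (((u : Matrix.SpecialLinearGroup (Fin 2) ℂ) :
        Matrix (Fin 2) (Fin 2) ℂ))).toLinearMap LinearMap.id

/-- The Poincaré series of the algebra of `G`-invariants of `ℂ[x,y]`: its `n`-th
coefficient is the dimension of the space of degree-`n` invariants. -/
noncomputable def invariantsPoincareSeries
    (G : Subgroup (Matrix.SpecialLinearGroup (Fin 2) ℂ)) : PowerSeries ℂ :=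
  PowerSeries.mk fun n => ((Module.finrank ℂ (invariantsComponent G n) : ℕ) : ℂ)

theorem coeff_single_add_single_smul_X_add_smul_X_mul (a c : ℂ) (p : MvPolynomial (Fin 2) ℂ)
    (k l : ℕ) :
    coeff (Finsupp.single 0 k + Finsupp.single 1 l)
        ((a • X 0 + c • X 1 : MvPolynomial (Fin 2) ℂ) * p) =
      a * (if k = 0 then 0 else coeff (Finsupp.single 0 (k - 1) + Finsupp.single 1 l) p) +
      c * (if l = 0 then 0 else coeff (Finsupp.single 0 k + Finsupp.single 1 (l - 1)) p) := by
  have h0 : (Finsupp.single 0 k + Finsupp.single 1 l - Finsupp.single 0 1 : Fin 2 →₀ ℕ) =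
      Finsupp.single 0 (k - 1) + Finsupp.single 1 l := by
    ext i; fin_cases i <;> simp
  have h1 : (Finsupp.single 0 k + Finsupp.single 1 l - Finsupp.single 1 1 : Fin 2 →₀ ℕ) =
      Finsupp.single 0 k + Finsupp.single 1 (l - 1) := by
    ext i; fin_cases i <;> simp
  rw [add_mul, coeff_add, smul_mul_assoc, smul_mul_assoc, coeff_smul, coeff_smul, coeff_X_mul',
    coeff_X_mul', h0, h1]
  simp [ite_not]

/-- The trace of the substitution `X 0 ↦ a X 0 + c X 1`, `X 1 ↦ b X 0 + d X 1` on binary forms of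
degree `n`, computed in the monomial basis. -/
noncomputable def binaryFormTrace (a b c d : ℂ) (n : ℕ) : ℂ :=
  ∑ kl ∈ Finset.HasAntidiagonal.antidiagonal n,
    coeff (Finsupp.single 0 kl.1 + Finsupp.single 1 kl.2)
    ((a • X 0 + c • X 1 : MvPolynomial (Fin 2) ℂ) ^ kl.1 * (b • X 0 + d • X 1) ^ kl.2)

/-- The sum of the entries just above the diagonal that occurs in the recursion for
`binaryFormTrace`. -/
noncomputable def binaryFormOffTrace (a b c d : ℂ) (n : ℕ) : ℂ :=
  ∑ kl ∈ Finset.HasAntidiagonal.antidiagonal n,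
    coeff (Finsupp.single 0 (kl.1 + 1) + Finsupp.single 1 kl.2)
    ((a • X 0 + c • X 1 : MvPolynomial (Fin 2) ℂ) ^ kl.1 * (b • X 0 + d • X 1) ^ (kl.2 + 1))

theorem coeff_single_one_smul_X_add_smul_X_pow (b d : ℂ) (n : ℕ) :
    coeff (Finsupp.single 1 n) ((b • X 0 + d • X 1 : MvPolynomial (Fin 2) ℂ) ^ n) = d ^ n := by
  induction n with
  | zero => simp
  | succ n ih =>
    have := coeff_single_add_single_smul_X_add_smul_X_mul b d
      ((b • X 0 + d • X 1 : MvPolynomial (Fin 2) ℂ) ^ n) 0 (n + 1)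
    simp only [Finsupp.single_zero, zero_add] at this
    rw [pow_succ', this]
    simp [ih, pow_succ']

theorem binaryFormOffTrace_zero (a b c d : ℂ) :
    binaryFormOffTrace a b c d 0 = b * binaryFormTrace a b c d 0 := by
  simp [binaryFormOffTrace, binaryFormTrace]

theorem binaryFormOffTrace_succ (a b c d : ℂ) (n : ℕ) :
    binaryFormOffTrace a b c d (n + 1) =
      b * binaryFormTrace a b c d (n + 1) + d * binaryFormOffTrace a b c d n := by
  have key : ∀ k l : ℕ, coeff (Finsupp.single 0 (k + 1) + Finsupp.single 1 l)
      ((a • X 0 + c • X 1 : MvPolynomial (Fin 2) ℂ) ^ k * (b • X 0 + d • X 1) ^ (l + 1)) =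
      b * coeff (Finsupp.single 0 k + Finsupp.single 1 l)
        ((a • X 0 + c • X 1 : MvPolynomial (Fin 2) ℂ) ^ k * (b • X 0 + d • X 1) ^ l) +
      d * (if l = 0 then 0 else coeff (Finsupp.single 0 (k + 1) + Finsupp.single 1 (l - 1))
        ((a • X 0 + c • X 1 : MvPolynomial (Fin 2) ℂ) ^ k * (b • X 0 + d • X 1) ^ l)) := by
    intro k l
    rw [pow_succ', mul_left_comm, coeff_single_add_single_smul_X_add_smul_X_mul]
    simp
  conv_lhs => rw [binaryFormOffTrace]
  simp only [key, Finset.sum_add_distrib, ← Finset.mul_sum]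
  conv_lhs => enter [2, 2]; rw [Finset.Nat.sum_antidiagonal_succ']
  simp [binaryFormOffTrace, binaryFormTrace, -Finsupp.single_add]

theorem binaryFormTrace_one (a b c d : ℂ) :
    binaryFormTrace a b c d 1 = a + d := by
  have h := coeff_single_add_single_smul_X_add_smul_X_mul a c 1 1 0
  have h' := coeff_single_one_smul_X_add_smul_X_pow b d 1
  simp only [mul_one] at h
  simp [-coeff_add] at h
  simp only [pow_one] at h'
  simp [binaryFormTrace, Finset.Nat.sum_antidiagonal_succ, h, h', add_comm, -coeff_add]

theorem binaryFormTrace_add_two (a b c d : ℂ) (n : ℕ) :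
    binaryFormTrace a b c d (n + 2) = a * binaryFormTrace a b c d (n + 1) +
      c * binaryFormOffTrace a b c d n + d ^ (n + 2) := by
  have key : ∀ k l : ℕ, coeff (Finsupp.single 0 (k + 1) + Finsupp.single 1 l)
      ((a • X 0 + c • X 1 : MvPolynomial (Fin 2) ℂ) ^ (k + 1) * (b • X 0 + d • X 1) ^ l) =
      a * coeff (Finsupp.single 0 k + Finsupp.single 1 l)
        ((a • X 0 + c • X 1 : MvPolynomial (Fin 2) ℂ) ^ k * (b • X 0 + d • X 1) ^ l) +
      c * (if l = 0 then 0 else coeff (Finsupp.single 0 (k + 1) + Finsupp.single 1 (l - 1))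
        ((a • X 0 + c • X 1 : MvPolynomial (Fin 2) ℂ) ^ k * (b • X 0 + d • X 1) ^ l)) := by
    intro k l
    rw [pow_succ', mul_assoc, coeff_single_add_single_smul_X_add_smul_X_mul]
    simp
  conv_lhs => rw [binaryFormTrace, Finset.Nat.sum_antidiagonal_succ]
  simp only [key, Finset.sum_add_distrib, ← Finset.mul_sum]
  conv_lhs => enter [2, 2, 2]; rw [Finset.Nat.sum_antidiagonal_succ']
  simp [binaryFormOffTrace, binaryFormTrace, coeff_single_one_smul_X_add_smul_X_pow,
    -Finsupp.single_add]
  ring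

theorem binaryFormTrace_recursion (a b c d : ℂ) (n : ℕ) :
    binaryFormTrace a b c d (n + 2) + (a * d - b * c) * binaryFormTrace a b c d n =
      (a + d) * binaryFormTrace a b c d (n + 1) := by
  have h0 : binaryFormTrace a b c d 0 = 1 := by simp [binaryFormTrace]
  cases n with
  | zero =>
    rw [binaryFormTrace_add_two, binaryFormOffTrace_zero, binaryFormTrace_one, h0]
    ring
  | succ n =>
    have h1 := binaryFormTrace_add_two a b c d (n + 1)
    have h2 := binaryFormTrace_add_two a b c d n
    rw [binaryFormOffTrace_succ] at h1
    linear_combination h1 - d * h2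

/-- Binary forms of degree `n` in coordinates with respect to the monomials `X₀ᵏ X₁ˡ`. -/
noncomputable def homogeneousSubmoduleFinTwoBasis (n : ℕ) :
    Module.Basis (Finset.HasAntidiagonal.antidiagonal n) ℂ (homogeneousSubmodule (Fin 2) ℂ n) :=
  Module.Basis.ofEquivFun
    { toFun := fun p kl =>
        coeff (Finsupp.single 0 kl.1.1 + Finsupp.single 1 kl.1.2) (p : MvPolynomial (Fin 2) ℂ)
      map_add' := fun p q => by ext; simp
      map_smul' := fun r p => by ext; simp
      invFun := fun f => ∑ kl, ⟨monomial (Finsupp.single 0 kl.1.1 + Finsupp.single 1 kl.1.2) (f kl),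
        (mem_homogeneousSubmodule _ _).2 (isHomogeneous_monomial _ (by
          simpa [Finsupp.degree_eq_sum] using Finset.HasAntidiagonal.mem_antidiagonal.1 kl.2))⟩
      left_inv := fun p => by
        ext m
        simp only [AddSubmonoidClass.coe_finsetSum, coeff_sum, coeff_monomial]
        by_cases hm : m.degree = n
        · have h : (m 0, m 1) ∈ Finset.HasAntidiagonal.antidiagonal n := by
            simpa [Finsupp.degree_eq_sum] using hm
          have hm' : Finsupp.single 0 (m 0) + Finsupp.single 1 (m 1) = m := by
            ext i; fin_cases i <;> simp
          rw [Finset.sum_eq_single_of_mem ⟨(m 0, m 1), h⟩ (Finset.mem_univ _)]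
          · simp [hm']
          · rintro ⟨⟨k, l⟩, hkl⟩ - hne
            rw [if_neg]
            rintro rfl
            simp at hne
        · rw [p.2.coeff_eq_zero hm]
          refine Finset.sum_eq_zero fun kl _ => if_neg ?_
          rintro rfl
          exact hm (by
            simpa [Finsupp.degree_eq_sum] using Finset.HasAntidiagonal.mem_antidiagonal.1 kl.2)
      right_inv := fun f => by
        ext kl
        simp only [AddSubmonoidClass.coe_finsetSum, coeff_sum, coeff_monomial]
        rw [Finset.sum_eq_single_of_mem kl (Finset.mem_univ _)]
        · simp
        · intro kl' _ hne
          rw [if_neg]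
          intro h
          apply hne
          have h0 := DFunLike.congr_fun h 0
          have h1 := DFunLike.congr_fun h 1
          simp at h0 h1
          exact Subtype.ext (Prod.ext h0 h1) }

instance (n : ℕ) : Module.Finite ℂ (homogeneousSubmodule (Fin 2) ℂ n) :=
  .of_basis (homogeneousSubmoduleFinTwoBasis n)

theorem coe_homogeneousSubmoduleFinTwoBasis (n : ℕ) (kl : Finset.HasAntidiagonal.antidiagonal n) :
    (homogeneousSubmoduleFinTwoBasis n kl : MvPolynomial (Fin 2) ℂ) =
      X 0 ^ kl.1.1 * X 1 ^ kl.1.2 := by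
  classical
  simp only [homogeneousSubmoduleFinTwoBasis, Module.Basis.coe_ofEquivFun]
  change ((∑ kl', _ : homogeneousSubmodule (Fin 2) ℂ n) : MvPolynomial (Fin 2) ℂ) = _
  rw [AddSubmonoidClass.coe_finsetSum, Finset.sum_eq_single_of_mem kl (Finset.mem_univ _)]
  · simp [X_pow_eq_monomial, monomial_mul]
  · intro kl' _ hne
    simp [hne]

theorem isHomogeneous_matrixSubst (u : Matrix (Fin 2) (Fin 2) ℂ) {n : ℕ}
    {p : MvPolynomial (Fin 2) ℂ} (hp : p ∈ homogeneousSubmodule (Fin 2) ℂ n) :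
    matrixSubst u p ∈ homogeneousSubmodule (Fin 2) ℂ n := by
  have hlin (i : Fin 2) : ∑ j, u j i • X j ∈ homogeneousSubmodule (Fin 2) ℂ 1 :=
    Submodule.sum_mem _ fun j _ => Submodule.smul_mem _ _ (isHomogeneous_X ℂ j)
  simpa [matrixSubst] using IsHomogeneous.aeval hp _ hlin

theorem trace_matrixSubst_restrict (u : Matrix (Fin 2) (Fin 2) ℂ) (n : ℕ) :
    LinearMap.trace ℂ (homogeneousSubmodule (Fin 2) ℂ n)
        ((matrixSubst u).toLinearMap.restrict fun _ => isHomogeneous_matrixSubst u) =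
      binaryFormTrace (u 0 0) (u 0 1) (u 1 0) (u 1 1) n := by
  classical
  rw [LinearMap.trace_eq_matrix_trace ℂ (homogeneousSubmoduleFinTwoBasis n), Matrix.trace,
    binaryFormTrace, ← Finset.sum_coe_sort (Finset.HasAntidiagonal.antidiagonal n)]
  refine Finset.sum_congr rfl fun kl _ => ?_
  rw [Matrix.diag_apply, LinearMap.toMatrix_apply]
  change coeff (Finsupp.single 0 kl.1.1 + Finsupp.single 1 kl.1.2 : Fin 2 →₀ ℕ)
    (matrixSubst u (homogeneousSubmoduleFinTwoBasis n kl : MvPolynomial (Fin 2) ℂ)) = _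
  rw [coe_homogeneousSubmoduleFinTwoBasis]
  simp [matrixSubst]

theorem matrixSubst_mul (u v : Matrix (Fin 2) (Fin 2) ℂ) :
    matrixSubst (u * v) = (matrixSubst u).comp (matrixSubst v) := by
  ext1 i
  simp only [matrixSubst, aeval_X, AlgHom.comp_apply, map_sum, map_smul]
  simp only [Matrix.mul_apply, Fin.sum_univ_two, smul_add, smul_smul, add_smul]
  simp only [mul_comm]
  abel

theorem matrixSubst_one : matrixSubst 1 = AlgHom.id ℂ (MvPolynomial (Fin 2) ℂ) := by
  ext1 i
  fin_cases i <;> simp [matrixSubst]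

section Matrix

open Matrix

theorem Matrix.adjugate_apply_same {n R : Type*} [Fintype n] [DecidableEq n] [CommRing R]
    (A : Matrix n n R) (i : n) :
    A.adjugate i i = (A.submatrix (Subtype.val : {j // j ≠ i} → n) Subtype.val).det := by
  rw [adjugate_apply, twoBlockTriangular_det _ (fun j => j ≠ i)]
  · have : Unique {j // ¬ j ≠ i} := ⟨⟨⟨i, by simp⟩⟩, fun j => Subtype.ext (by simpa using j.2)⟩
    have h2 : (toSquareBlockProp (A.updateRow i (Pi.single i 1)) fun j => ¬ j ≠ i).det = 1 := by
      rw [det_unique]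
      have : ((default : {j // ¬ j ≠ i}) : n) = i := by simpa using (default : {j // ¬ j ≠ i}).2
      simp [toSquareBlockProp, this]
    rw [h2, mul_one]
    congr 1
    ext j k
    simp [toSquareBlockProp, j.2]
  · intro j hj k hk
    obtain rfl : j = i := by simpa using hj
    simp [hk]

/-- **Cramer's rule** for a unit right-hand side, at the diagonal entry. -/
theorem Matrix.mul_det_eq_det_submatrix_of_mulVec_eq_single {n R : Type*} [Fintype n]
    [DecidableEq n] [CommRing R] {A : Matrix n n R} {v : n → R} {i : n}
    (h : A *ᵥ v = Pi.single i 1) :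
    v i * A.det = (A.submatrix (Subtype.val : {j // j ≠ i} → n) Subtype.val).det := by
  rw [← adjugate_apply_same, mul_comm, ← smul_eq_mul, ← Pi.smul_apply, ← one_mulVec v,
    ← smul_mulVec, ← adjugate_mul, ← mulVec_mulVec, h]
  simp

open scoped ComplexOrder in
theorem Matrix.trace_map_inv_eq_star_trace {G n : Type*} [Group G] [Fintype G] [Fintype n]
    [DecidableEq n] (M : G →* Matrix n n ℂ) (g : G) :
    (M g⁻¹).trace = star (M g).trace := by
  set H : Matrix n n ℂ := ∑ h : G, (M h)ᴴ * M h with hH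
  have hpos : H.PosDef := by
    classical
    rw [hH, ← Finset.add_sum_erase _ _ (Finset.mem_univ 1)]
    refine PosDef.add_posSemidef (by simpa using PosDef.one)
      (posSemidef_sum _ fun h _ => posSemidef_conjTranspose_mul_self (M h))
  have hinv : (M g)ᴴ * H * M g = H := by
    rw [hH, Finset.mul_sum, Finset.sum_mul]
    refine Fintype.sum_equiv (Equiv.mulRight g) _ _ fun h => ?_
    simp [Matrix.mul_assoc]
  have hmul : M g * M g⁻¹ = 1 := by rw [← map_mul]; simp
  have key : (M g)ᴴ = H * M g⁻¹ * H⁻¹ := by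
    have h1 : (M g)ᴴ * H = H * M g⁻¹ := by
      calc (M g)ᴴ * H = (M g)ᴴ * H * (M g * M g⁻¹) := by rw [hmul, mul_one]
        _ = H * M g⁻¹ := by rw [← mul_assoc, hinv]
    rw [← h1, mul_assoc, mul_nonsing_inv _ ((isUnit_iff_isUnit_det _).1 hpos.isUnit), mul_one]
  rw [← trace_conjTranspose, key, trace_mul_comm, ← mul_assoc,
    nonsing_inv_mul _ ((isUnit_iff_isUnit_det _).1 hpos.isUnit), one_mul]

end Matrix

section Representation

open Representation

theorem FDRep.character_inv_eq_conj {G : Type} [Group G] [Fintype G] (V : FDRep ℂ G) (g : G) :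
    V.character g⁻¹ = starRingEnd ℂ (V.character g) := by
  have b := Module.finBasis ℂ V
  simp only [FDRep.character, LinearMap.trace_eq_matrix_trace ℂ b]
  exact Matrix.trace_map_inv_eq_star_trace
    ((LinearMap.toMatrixAlgEquiv b).toAlgHom.toMonoidHom.comp V.ρ) g

theorem Subrepresentation.character_add_of_isCompl {k G V : Type*} [Field k] [Group G]
    [AddCommGroup V] [Module k V] [FiniteDimensional k V] {ρ : Representation k G V}
    {p q : Subrepresentation ρ} (h : IsCompl p.toSubmodule q.toSubmodule) :
    ρ.character = p.toRepresentation.character + q.toRepresentation.character := by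
  ext g
  let N : Bool → Submodule k V := fun b => cond b p.toSubmodule q.toSubmodule
  have hN : DirectSum.IsInternal N :=
    (DirectSum.isInternal_submodule_iff_isCompl N (i := true) (j := false) (by simp)
      (by ext b; cases b <;> simp)).2 h
  have hf : ∀ b, Set.MapsTo (ρ g) (N b) (N b) := by
    rintro (_ | _)
    · exact q.apply_mem_toSubmodule g
    · exact p.apply_mem_toSubmodule g
  have := LinearMap.trace_eq_sum_trace_restrict hN hf
  rw [Fintype.sum_bool] at this
  exact this

theorem Subrepresentation.isCompl_toSubmodule {k G V : Type*} [Field k] [Group G]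
    [AddCommGroup V] [Module k V] {ρ : Representation k G V}
    {p q : Subrepresentation ρ} (h : IsCompl p q) : IsCompl p.toSubmodule q.toSubmodule := by
  rw [isCompl_iff, disjoint_iff, codisjoint_iff] at *
  exact ⟨congrArg toSubmodule h.1, congrArg toSubmodule h.2⟩

theorem FDRep.simple_of_isIrreducible {G V : Type} [Group G] [Finite G] [AddCommGroup V]
    [Module ℂ V] [FiniteDimensional ℂ V] (ρ : Representation ℂ G V) [IsIrreducible ρ] :
    Simple (FDRep.of ρ) := by
  have := Fintype.ofFinite G
  have hne : (Nat.card G : ℂ) ≠ 0 := NeZero.ne _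
  have := invertibleOfNonzero hne
  rw [FDRep.simple_iff_char_is_norm_one]
  have h := Representation.char_orthonormal ρ ρ
  rw [if_pos ⟨Representation.Equiv.refl ρ⟩, inv_mul_eq_one₀ hne] at h
  exact h.symm

/-- By Maschke's theorem, every character of a finite group is a linear combination of irreducible
characters. -/
theorem Representation.character_mem_span_of_forall_simple {G : Type} [Group G] [Finite G]
    {S : Submodule ℂ (G → ℂ)} (hS : ∀ V : FDRep ℂ G, Simple V → V.character ∈ S)
    {V : Type} [AddCommGroup V] [Module ℂ V] [FiniteDimensional ℂ V]
    (ρ : Representation ℂ G V) : ρ.character ∈ S := by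
  induction hn : Module.finrank ℂ V using Nat.strong_induction_on generalizing V with
  | _ n ih =>
    subst hn
    by_cases hρ : IsIrreducible ρ
    · exact hS _ (FDRep.simple_of_isIrreducible ρ)
    rcases subsingleton_or_nontrivial V with hV | hV
    · have : ρ.character = 0 := by
        ext g
        rw [Representation.character, Subsingleton.elim (ρ g) 0, map_zero, Pi.zero_apply]
      rw [this]
      exact S.zero_mem
    have hnt : Nontrivial (Subrepresentation ρ) := by
      refine ⟨⊥, ⊤, fun h => ?_⟩
      exact bot_ne_top (α := Submodule ℂ V) (congrArg Subrepresentation.toSubmodule h)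
    obtain ⟨p, hp⟩ : ∃ p : Subrepresentation ρ, ¬ (p = ⊥ ∨ p = ⊤) := by
      by_contra! h
      exact hρ ⟨h⟩
    rw [not_or] at hp
    obtain ⟨q, hpq⟩ := exists_isCompl p
    have hlt : ∀ r : Subrepresentation ρ, r ≠ ⊤ →
        Module.finrank ℂ r.toSubmodule < Module.finrank ℂ V := fun r hr =>
      Submodule.finrank_lt fun h => hr (Subrepresentation.toSubmodule_injective h)
    rw [Subrepresentation.character_add_of_isCompl (Subrepresentation.isCompl_toSubmodule hpq)]
    refine S.add_mem (ih _ (hlt p hp.2) _ rfl) (ih _ (hlt q ?_) _ rfl)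
    rintro rfl
    exact hp.1 (by simpa using hpq.inf_eq_bot)

end Representation

/-- The action of a group of matrices on binary forms of degree `n`. -/
noncomputable def binaryFormRep (G : Subgroup (Matrix.SpecialLinearGroup (Fin 2) ℂ)) (n : ℕ) :
    Representation ℂ G (homogeneousSubmodule (Fin 2) ℂ n) where
  toFun g := (matrixSubst (g : Matrix.SpecialLinearGroup (Fin 2) ℂ)).toLinearMap.restrict
    fun _ => isHomogeneous_matrixSubst _
  map_one' := by
    ext1 p
    apply Subtype.ext
    simp [matrixSubst_one]
  map_mul' g h := by
    ext1 p
    apply Subtype.ext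
    simp [matrixSubst_mul]
    rfl

theorem finrank_invariantsComponent (G : Subgroup (Matrix.SpecialLinearGroup (Fin 2) ℂ)) (n : ℕ) :
    Module.finrank ℂ (invariantsComponent G n) =
      Module.finrank ℂ (binaryFormRep G n).invariants := by
  have h : (binaryFormRep G n).invariants.map (homogeneousSubmodule (Fin 2) ℂ n).subtype =
      invariantsComponent G n := by
    ext p
    simp only [invariantsComponent, Submodule.mem_map, Submodule.mem_inf, Submodule.mem_iInf,
      LinearMap.mem_eqLocus, Representation.mem_invariants]
    constructor
    · rintro ⟨q, hq, rfl⟩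
      exact ⟨q.2, fun g => congrArg Subtype.val (hq g)⟩
    · rintro ⟨hp, hinv⟩
      exact ⟨⟨p, hp⟩, fun g => Subtype.ext (hinv g), rfl⟩
  rw [← h]
  exact (Submodule.equivMapOfInjective _ (Submodule.subtype_injective _) _).finrank_eq.symm

theorem character_binaryFormRep (G : Subgroup (Matrix.SpecialLinearGroup (Fin 2) ℂ)) (n : ℕ)
    (g : G) : (binaryFormRep G n).character g =
      binaryFormTrace (g.1.1 0 0) (g.1.1 0 1) (g.1.1 1 0) (g.1.1 1 1) n :=
  trace_matrixSubst_restrict _ _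

theorem character_binaryFormRep_zero (G : Subgroup (Matrix.SpecialLinearGroup (Fin 2) ℂ))
    (g : G) : (binaryFormRep G 0).character g = 1 := by
  rw [character_binaryFormRep]
  simp [binaryFormTrace]

theorem character_binaryFormRep_one (G : Subgroup (Matrix.SpecialLinearGroup (Fin 2) ℂ))
    (g : G) : (binaryFormRep G 1).character g =
      Matrix.trace ((g : Matrix.SpecialLinearGroup (Fin 2) ℂ) : Matrix (Fin 2) (Fin 2) ℂ) := by
  rw [character_binaryFormRep, binaryFormTrace_one, Matrix.trace_fin_two]

/-- The Clebsch–Gordan recursion for the characters of binary forms. -/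
theorem character_binaryFormRep_add_two (G : Subgroup (Matrix.SpecialLinearGroup (Fin 2) ℂ))
    (n : ℕ) (g : G) :
    (binaryFormRep G (n + 2)).character g + (binaryFormRep G n).character g =
      Matrix.trace ((g : Matrix.SpecialLinearGroup (Fin 2) ℂ) : Matrix (Fin 2) (Fin 2) ℂ) *
        (binaryFormRep G (n + 1)).character g := by
  have hdet := g.1.2
  rw [Matrix.det_fin_two] at hdet
  have h := binaryFormTrace_recursion (g.1.1 0 0) (g.1.1 0 1) (g.1.1 1 0) (g.1.1 1 1) n
  rw [hdet, one_mul] at h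
  simpa only [character_binaryFormRep, Matrix.trace_fin_two] using h

/-- The inner product of class functions, as a linear form in the first argument. -/
noncomputable def characterPairing {G : Type*} [Fintype G] (ψ : G → ℂ) : (G → ℂ) →ₗ[ℂ] ℂ :=
  (1 / (Fintype.card G : ℂ)) • ∑ g : G, starRingEnd ℂ (ψ g) • LinearMap.proj g

theorem characterPairing_apply {G : Type*} [Fintype G] (ψ φ : G → ℂ) :
    characterPairing ψ φ =
      (1 / (Fintype.card G : ℂ)) * ∑ g : G, φ g * starRingEnd ℂ (ψ g) := by
  simp [characterPairing, mul_comm]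

theorem characterPairing_character {G : Type} [Group G] [Fintype G] (V W : FDRep ℂ G) [Simple V]
    [Simple W] [Decidable (Nonempty (W ≅ V))] :
    characterPairing V.character W.character = if Nonempty (W ≅ V) then 1 else 0 := by
  have := invertibleOfNonzero (NeZero.ne (Nat.card G : ℂ))
  rw [characterPairing_apply, ← Nat.card_eq_fintype_card, one_div]
  simp only [← FDRep.character_inv_eq_conj]
  rw [FDRep.char_orthonormal]
  congr

/-- Fourier expansion of a combination of orthonormal functions, in terms of pairings with
`φ • -`. -/
theorem sum_characterPairing_mul_of_mem_span {G ι : Type*} [Fintype G] [Fintype ι] [DecidableEq ι]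
    {χ : ι → G → ℂ} (hχ : ∀ i j, characterPairing (χ i) (χ j) = if i = j then 1 else 0)
    (T : (G → ℂ) →ₗ[ℂ] ℂ) {f : G → ℂ} (hf : f ∈ Submodule.span ℂ (Set.range χ)) :
    ∑ j, T (χ j) * characterPairing (χ j) f = T f := by
  induction hf using Submodule.span_induction with
  | mem f hf =>
    obtain ⟨i, rfl⟩ := hf
    simp [hχ]
  | zero => simp
  | add f g _ _ hf hg => simp [mul_add, Finset.sum_add_distrib, hf, hg]
  | smul c f _ hf => simp [mul_left_comm _ c, ← Finset.mul_sum, hf]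

section McKay

open Matrix

/-- If the coefficients `a n : ι → R` satisfy the Chebyshev recursion governed by `B`, their
generating vector solves the linear system with matrix `(1 + t²) - t B`. -/
theorem one_add_X_sq_sub_X_smul_mulVec_mk {R ι : Type*} [CommRing R] [Fintype ι] [DecidableEq ι]
    (B : Matrix ι ι R) (a : ℕ → ι → R) (h₁ : B *ᵥ a 0 = a 1)
    (h₂ : ∀ n, B *ᵥ a (n + 1) = a (n + 2) + a n) :
    ((1 + (PowerSeries.X : PowerSeries R) ^ 2) • (1 : Matrix ι ι (PowerSeries R)) -
        (PowerSeries.X : PowerSeries R) • B.map PowerSeries.C) *ᵥ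
      (fun i => PowerSeries.mk fun n => a n i) = fun i => PowerSeries.C (a 0 i) := by
  have hB (i : ι) : (B.map PowerSeries.C *ᵥ fun i => PowerSeries.mk fun n => a n i) i =
      PowerSeries.mk fun n => (B *ᵥ a n) i := by
    ext n
    simp [mulVec, dotProduct]
  ext i n
  rw [sub_mulVec, smul_mulVec, smul_mulVec, one_mulVec, Pi.sub_apply, Pi.smul_apply, Pi.smul_apply,
    hB, smul_eq_mul, smul_eq_mul, add_mul, one_mul, pow_two, mul_assoc]
  rcases n with _ | _ | n
  · simp
  · simp [PowerSeries.coeff_succ_X_mul, h₁]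
  · simp [PowerSeries.coeff_succ_X_mul, h₂]

end McKay

theorem map_det_one_add_X_sq_sub_X_smul {R ι : Type*} [CommRing R] [Fintype ι] [DecidableEq ι]
    (B : Matrix ι ι R) :
    (((1 + (Polynomial.X : Polynomial R) ^ 2) • (1 : Matrix ι ι (Polynomial R)) -
        (Polynomial.X : Polynomial R) • B.map Polynomial.C).det : PowerSeries R) =
      ((1 + (PowerSeries.X : PowerSeries R) ^ 2) • (1 : Matrix ι ι (PowerSeries R)) -
        (PowerSeries.X : PowerSeries R) • B.map PowerSeries.C).det := by
  rw [← Polynomial.coeToPowerSeries.ringHom_apply, RingHom.map_det]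
  congr 1
  ext1 i j
  simp only [RingHom.mapMatrix_apply, Matrix.map_apply, Matrix.sub_apply, Matrix.smul_apply,
    Matrix.one_apply, smul_eq_mul, Polynomial.coeToPowerSeries.ringHom_apply]
  split_ifs <;> simp [mul_comm PowerSeries.X]

/-- Ebeling's theorem in Cramer/matrix form: for a finite subgroup `G` of `SU(2)` with
Poincaré series `P` of the invariant algebra, McKay matrix `B` (built from a complete
family of pairwise non-isomorphic irreducible representations `ρ_i`, with `ρ_{i₀}`
trivial) and `B°` the submatrix of `B` with the trivial index deleted, one has
`P ⬝ det((1 + t²) • 1 − t • B) = det((1 + t²) • 1 − t • B°)` in `ℂ⟦t⟧`. -/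
theorem ebeling_cramer_form (G : Subgroup (Matrix.SpecialLinearGroup (Fin 2) ℂ))
    [Fintype G]
    (hG : ∀ g : G, ((g : Matrix.SpecialLinearGroup (Fin 2) ℂ) : Matrix (Fin 2) (Fin 2) ℂ)
      ∈ Matrix.specialUnitaryGroup (Fin 2) ℂ)
    (ι : Type) [Fintype ι] [DecidableEq ι] (ρ : ι → FDRep ℂ G)
    (hsimple : ∀ i, Simple (ρ i))
    (hdist : ∀ i j, i ≠ j → ¬ Nonempty (ρ i ≅ ρ j))
    (hall : ∀ V : FDRep ℂ G, Simple V → ∃ i, Nonempty (V ≅ ρ i))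
    (i₀ : ι) (htriv : ∀ g : G, (ρ i₀).character g = 1)
    (χemb : G → ℂ)
    (hχemb : ∀ g : G, χemb g =
      Matrix.trace (((g : Matrix.SpecialLinearGroup (Fin 2) ℂ) : Matrix (Fin 2) (Fin 2) ℂ)))
    (B : Matrix ι ι ℂ)
    (hB : ∀ i j, B i j = (1 / (Fintype.card G : ℂ)) *
      ∑ g : G, (χemb g * (ρ j).character g) * (starRingEnd ℂ) ((ρ i).character g))
    (B₀ : Matrix {i : ι // i ≠ i₀} {i : ι // i ≠ i₀} ℂ)
    (hB₀ : ∀ i j, B₀ i j = B i.1 j.1) :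
    invariantsPoincareSeries G *
        ↑(((1 + (Polynomial.X : Polynomial ℂ) ^ 2) • (1 : Matrix ι ι (Polynomial ℂ))
            - (Polynomial.X : Polynomial ℂ) • B.map Polynomial.C).det)
      = ↑(((1 + (Polynomial.X : Polynomial ℂ) ^ 2) •
              (1 : Matrix {i : ι // i ≠ i₀} {i : ι // i ≠ i₀} (Polynomial ℂ))
            - (Polynomial.X : Polynomial ℂ) • B₀.map Polynomial.C).det) := by
  let χ : ι → G → ℂ := fun i => (ρ i).character
  let ψ : ℕ → G → ℂ := fun n => (binaryFormRep G n).character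
  have hχ : ∀ i j, characterPairing (χ i) (χ j) = if i = j then 1 else 0 := by
    classical
    intro i j
    rw [characterPairing_character]
    refine if_congr ⟨fun h => ?_, ?_⟩ rfl rfl
    · by_contra hij
      exact hdist j i (Ne.symm hij) h
    · rintro rfl
      exact ⟨Iso.refl _⟩
  have hψ : ∀ n, ψ n ∈ Submodule.span ℂ (Set.range χ) := fun n =>
    Representation.character_mem_span_of_forall_simple (fun V hV => by
      obtain ⟨i, ⟨e⟩⟩ := hall V hV
      rw [FDRep.char_iso e]
      exact Submodule.subset_span ⟨i, rfl⟩) _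
  have hψ_zero : ψ 0 = χ i₀ := funext fun g =>
    (character_binaryFormRep_zero G g).trans (htriv g).symm
  have hψ_one : χemb * ψ 0 = ψ 1 := funext fun g => by
    simp only [Pi.mul_apply, ψ, hχemb, character_binaryFormRep_zero, character_binaryFormRep_one,
      mul_one]
  have hψ_add_two (n : ℕ) : χemb * ψ (n + 1) = ψ (n + 2) + ψ n := funext fun g => by
    simp only [Pi.mul_apply, Pi.add_apply, ψ, hχemb, character_binaryFormRep_add_two]
  let a : ℕ → ι → ℂ := fun n i => characterPairing (χ i) (ψ n)
  have hBa : ∀ n i, (B.mulVec (a n)) i = characterPairing (χ i) (χemb * ψ n) := by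
    intro n i
    have h := sum_characterPairing_mul_of_mem_span hχ
      (characterPairing (χ i) ∘ₗ LinearMap.mulLeft ℂ χemb) (hψ n)
    rw [LinearMap.comp_apply, LinearMap.mulLeft_apply] at h
    rw [← h]
    refine Finset.sum_congr rfl fun j _ => ?_
    simp only [hB, LinearMap.comp_apply, LinearMap.mulLeft_apply, characterPairing_apply,
      Pi.mul_apply, a, χ]
  have ha_one : B.mulVec (a 0) = a 1 := by
    ext i
    rw [hBa, hψ_one]
  have ha_add_two : ∀ n, B.mulVec (a (n + 1)) = a (n + 2) + a n := by
    intro n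
    ext i
    rw [hBa, hψ_add_two, map_add, Pi.add_apply]
  have hP : invariantsPoincareSeries G = PowerSeries.mk fun n => a n i₀ := by
    ext n
    simp only [a, ψ, χ]
    rw [invariantsPoincareSeries, PowerSeries.coeff_mk, PowerSeries.coeff_mk,
      finrank_invariantsComponent, ← Representation.card_inv_mul_sum_char_eq_finrank,
      characterPairing_apply, Nat.card_eq_fintype_card, one_div]
    simp [htriv]
  have hsys := one_add_X_sq_sub_X_smul_mulVec_mk B a ha_one ha_add_two
  have hunit : (fun i => PowerSeries.C (a 0 i)) = Pi.single i₀ (1 : PowerSeries ℂ) := by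
    ext1 i
    simp only [a, hψ_zero, hχ, Pi.single_apply]
    split_ifs <;> simp
  rw [hunit] at hsys
  rw [map_det_one_add_X_sq_sub_X_smul, map_det_one_add_X_sq_sub_X_smul, hP,
    Matrix.mul_det_eq_det_submatrix_of_mulVec_eq_single hsys]
  congr 1
  ext1 i j
  simp [Matrix.one_apply, hB₀, Subtype.ext_iff]
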